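/- Let q be a prime power, K a finite field with q elements, K̄ an algebraic closure of K, and φ the Frobenius map on P¹(K̄) given by [a : b] ↦ [a^q : b^q]. The number of ordered 6-tuples (x₁, …, x₆) of pairwise distinct points of P¹(K̄) satisfying φ(x₁) = x₂, φ(x₂) = x₃, φ(x₃) = x₁, φ(x₄) = x₅, φ(x₅) = x₆ and φ(x₆) = x₄ equals (q³ − q)(q³ − q − 3). -/

import Mathlib

open Projectivization

/-- The Frobenius map on the projective line `P¹(L)`, acting in homogeneous coordinates by
`[a : b] ↦ [a ^ q : b ^ q]`. -/
noncomputable def frobP1 {L : Type*} [Field L] (q : ℕ)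
    (x : Projectivization L (Fin 2 → L)) : Projectivization L (Fin 2 → L) :=
  Projectivization.mk L (fun i => (x.rep i) ^ q) (by
    intro hzero
    obtain ⟨i, hi⟩ := Function.ne_iff.mp x.rep_nonzero
    have h2 : x.rep i ^ q = 0 := congrFun hzero i
    exact hi (by simpa using (pow_eq_zero_iff'.mp h2).1))

/-- The Frobenius map acts on homogeneous coordinates independently of the representative. -/
lemma frobP1_mk {L : Type*} [Field L] (q : ℕ) (v : Fin 2 → L) (hv : v ≠ 0)
    (hv' : (fun i => v i ^ q) ≠ 0) :
    frobP1 q (Projectivization.mk L v hv) = Projectivization.mk L (fun i => v i ^ q) hv' := by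
  obtain ⟨a, ha⟩ := Projectivization.exists_smul_eq_mk_rep L v hv
  rw [frobP1, Projectivization.mk_eq_mk_iff]
  refine ⟨a ^ q, funext fun i => ?_⟩
  rw [← ha]
  simp [Units.smul_def, mul_pow]

/-- In the affine coordinate, the Frobenius map is the `q`-power map fixing `∞`. -/
lemma frobP1_semiconj {L : Type*} [Field L] [DecidableEq L] {q : ℕ} (hq : q ≠ 0) :
    Function.Semiconj (OnePoint.equivProjectivization L) (OnePoint.map (· ^ q)) (frobP1 q) := by
  intro t
  induction t using OnePoint.rec with
  | infty =>
    rw [OnePoint.map_infty, OnePoint.equivProjectivization_apply_infinity, frobP1_mk]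
    · congr 1
      ext i
      fin_cases i <;> simp [hq]
    · exact fun h => by simpa using congrFun h 0
  | coe t =>
    rw [OnePoint.map_some, OnePoint.equivProjectivization_apply_coe,
      OnePoint.equivProjectivization_apply_coe, frobP1_mk]
    · congr 1
      ext i
      fin_cases i <;> simp
    · exact fun h => by simpa using congrFun h 1

lemma OnePoint.map_iterate {X : Type*} (f : X → X) (m : ℕ) :
    (OnePoint.map f)^[m] = OnePoint.map f^[m] := by
  induction m with
  | zero => simp
  | succ m ih => rw [Function.iterate_succ, Function.iterate_succ, ih, OnePoint.map_comp]

/-- An algebraically closed field of characteristic `p` has exactly `n` solutions of `t ^ n = t`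
when `p ∣ n` and `1 < n`. -/
lemma ncard_pow_eq_self {L : Type*} [Field L] [IsAlgClosed L] (p : ℕ) [CharP L p] {n : ℕ}
    (hp : p ∣ n) (hn : 1 < n) : {t : L | t ^ n = t}.ncard = n := by
  classical
  have hsep : (Polynomial.X ^ n - Polynomial.X : Polynomial L).Separable :=
    galois_poly_separable p n hp
  have hcard := Polynomial.card_rootSet_eq_natDegree (K := L) hsep (IsAlgClosed.splits _)
  rw [FiniteField.X_pow_card_sub_X_natDegree_eq L hn, ← Nat.card_eq_fintype_card,
    Nat.card_coe_set_eq] at hcard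
  convert hcard using 2
  ext t
  rw [Polynomial.mem_rootSet_of_ne (FiniteField.X_pow_card_sub_X_ne_zero L hn)]
  simp [sub_eq_zero]

/-- The number of points of the projective line over the degree `m` extension of `𝔽_q`. -/
lemma ncard_frobP1_iterate_eq_self {L : Type*} [Field L] [IsAlgClosed L] (p : ℕ) [CharP L p]
    {q : ℕ} (hp : p ∣ q) (hq : 1 < q) {m : ℕ} (hm : m ≠ 0) :
    {x | (frobP1 (L := L) q)^[m] x = x}.ncard = q ^ m + 1 := by
  classical
  have hcard := ncard_pow_eq_self (L := L) p (hp.trans (dvd_pow_self q hm)) (Nat.one_lt_pow hm hq)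
  have hfin := Set.finite_of_ncard_ne_zero (hcard.trans_ne (by positivity))
  have hset : {x | (frobP1 (L := L) q)^[m] x = x} = OnePoint.equivProjectivization L ''
      insert OnePoint.infty ((↑) '' {t : L | t ^ q ^ m = t}) := by
    ext x
    obtain ⟨t, rfl⟩ := (OnePoint.equivProjectivization L).surjective x
    rw [Set.mem_ofPred_eq, ← ((frobP1_semiconj (by omega)).iterate_right m).eq,
      EmbeddingLike.apply_eq_iff_eq, (OnePoint.equivProjectivization L).injective.mem_set_image,
      OnePoint.map_iterate, pow_iterate]
    induction t using OnePoint.rec <;> simp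
  rw [hset, Set.ncard_image_of_injective _ (Equiv.injective _),
    Set.ncard_insert_of_notMem (by simp) (hfin.image _),
    Set.ncard_image_of_injective _ OnePoint.coe_injective, hcard]

/-- Counting ordered pairs of disjoint `3`-cycles of a map with chosen base points. -/
lemma card_pairs_of_three_cycles {α : Type*} (f : α → α) (S : Finset α)
    (hS : ∀ a, a ∈ S ↔ f (f (f a)) = a ∧ f a ≠ a) :
    (Nat.card {x : Fin 6 → α // Function.Injective x ∧ f (x 0) = x 1 ∧ f (x 1) = x 2 ∧
      f (x 2) = x 0 ∧ f (x 3) = x 4 ∧ f (x 4) = x 5 ∧ f (x 5) = x 3} : ℤ)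
    = S.card * (S.card - 3) := by
  classical
  let T : Finset (Σ _ : α, α) := S.sigma fun a => S \ {a, f a, f (f a)}
  have hT : (T.card : ℤ) = S.card * (S.card - 3) := by
    rw [Finset.card_sigma, Nat.cast_sum, ← nsmul_eq_mul]
    refine Finset.sum_eq_card_nsmul fun a ha => ?_
    obtain ⟨h1, h2⟩ := (hS a).1 ha
    have hsub : {a, f a, f (f a)} ⊆ S := by
      intro b hb
      simp only [Finset.mem_insert, Finset.mem_singleton] at hb
      rw [hS]
      grind
    have h3 : ({a, f a, f (f a)} : Finset α).card = 3 :=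
      Finset.card_eq_three.2 ⟨_, _, _, by grind, by grind, by grind, rfl⟩
    rw [Finset.cast_card_sdiff hsub, h3]
    rfl
  rw [← hT, ← Nat.card_eq_finsetCard]
  refine congrArg _ (Nat.card_eq_of_bijective (fun x => ⟨⟨x.1 0, x.1 3⟩, ?_⟩) ⟨?_, ?_⟩)
  · obtain ⟨x, hx, h0, h1, h2, h3, h4, h5⟩ := x
    have h (i j : Fin 6) : x i = x j ↔ i = j := hx.eq_iff
    simp [T, hS, h0, h1, h2, h3, h4, h5, h]
  · rintro ⟨x, hx, h0, h1, h2, h3, h4, h5⟩ ⟨y, hy, k0, k1, k2, k3, k4, k5⟩ hxy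
    obtain ⟨e0, e3⟩ : x 0 = y 0 ∧ x 3 = y 3 := by simpa using hxy
    ext i
    fin_cases i <;> grind
  · rintro ⟨⟨a, b⟩, hab⟩
    simp only [T, Finset.mem_sigma, Finset.mem_sdiff, Finset.mem_insert, Finset.mem_singleton,
      hS, not_or] at hab
    obtain ⟨⟨ha, ha'⟩, ⟨hb, hb'⟩, hba, hba', hba''⟩ := hab
    refine ⟨⟨![a, f a, f (f a), b, f b, f (f b)], ?_, rfl, rfl, ha, rfl, rfl, hb⟩, rfl⟩
    rw [← List.nodup_ofFn]
    simp
    grind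

/-- the number of injective 6-tuples of points of `P¹(K̄)`
satisfying the stated Frobenius conditions. -/
theorem statement15 (q : ℕ) (hq : IsPrimePow q)
    (K : Type*) [Field K] [Fintype K] (hK : Fintype.card K = q) :
    (Nat.card
      {x : Fin 6 → Projectivization (AlgebraicClosure K) (Fin 2 → AlgebraicClosure K) //
        Function.Injective x ∧
        frobP1 q (x 0) = x 1 ∧
        frobP1 q (x 1) = x 2 ∧
        frobP1 q (x 2) = x 0 ∧
        frobP1 q (x 3) = x 4 ∧
        frobP1 q (x 4) = x 5 ∧
        frobP1 q (x 5) = x 3} : ℤ)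
    = ((q : ℤ) ^ 3 - (q : ℤ)) * ((q : ℤ) ^ 3 - (q : ℤ) - 3) := by
  obtain ⟨p, hchar⟩ := CharP.exists K
  have : CharP (AlgebraicClosure K) p := charP_of_injective_algebraMap
    (algebraMap K (AlgebraicClosure K)).injective p
  have hpq : p ∣ q := by
    rw [← CharP.cast_eq_zero_iff K p, ← hK, Nat.cast_card_eq_zero]
  have h3 := ncard_frobP1_iterate_eq_self (L := AlgebraicClosure K) p hpq hq.one_lt three_ne_zero
  have h1 := ncard_frobP1_iterate_eq_self (L := AlgebraicClosure K) p hpq hq.one_lt one_ne_zero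
  generalize frobP1 (L := AlgebraicClosure K) q = f at h3 h1 ⊢
  have hfin := Set.finite_of_ncard_ne_zero (h3.trans_ne (Nat.succ_ne_zero _))
  have hsub : {x | f^[1] x = x} ⊆ {x | f^[3] x = x} := fun x (hx : f x = x) => by simp [hx]
  have hdiff := hfin.sdiff (t := {x | f^[1] x = x})
  have hcard : (hdiff.toFinset.card : ℤ) = (q : ℤ) ^ 3 - q := by
    rw [← Set.ncard_eq_toFinset_card _ hdiff, Set.cast_ncard_sdiff hsub hfin, h3, h1]
    push_cast
    ring
  rw [card_pairs_of_three_cycles f hdiff.toFinset (by simp), hcard]
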